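/- A nonempty set C ⊆ ℝ is compact, totally disconnected and dense in itself if and only if C = f(𝔻) for some strictly increasing bijection f from ℝ onto ℝ. -/

import Mathlib

noncomputable section

open Set Cardinal

/-- A Cantor set: a nonempty compact subset of ℝ that is totally disconnected
and dense in itself (no isolated points). -/
def IsCantorSet (C : Set ℝ) : Prop :=
  C.Nonempty ∧ IsCompact C ∧ IsTotallyDisconnected C ∧ Preperfect C

/-- The Cantor ternary set `𝔻 = {∑_{n=1}^∞ aₙ 3⁻ⁿ : aₙ ∈ {0,2}}`. -/
def cantorTernarySet : Set ℝ :=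
  {x | ∃ a : ℕ → ℝ, (∀ n, a n = 0 ∨ a n = 2) ∧ x = ∑' n : ℕ, a n / 3 ^ (n + 1)}

/-- A bounded gap of `C`: an open interval disjoint from `C` with both endpoints in `C`. -/
def IsGap (C : Set ℝ) (a b : ℝ) : Prop :=
  a ∈ C ∧ b ∈ C ∧ a < b ∧ ∀ x ∈ Ioo a b, x ∉ C

/-- The left endpoints of the bounded gaps of `C`. -/
def gapLeft (C : Set ℝ) : Set ℝ := {a | ∃ b, IsGap C a b}

section

variable {C D : Set ℝ}

lemma IsGap.le_of_mem_of_lt {a b x : ℝ} (h : IsGap C a b) (hx : x ∈ C) (hax : a < x) : b ≤ x := by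
  by_contra! hlt
  exact h.2.2.2 x ⟨hax, hlt⟩ hx

lemma IsGap.le_of_mem_of_gt {a b x : ℝ} (h : IsGap C a b) (hx : x ∈ C) (hxb : x < b) : x ≤ a := by
  by_contra! hlt
  exact h.2.2.2 x ⟨hlt, hxb⟩ hx

lemma exists_notMem_of_lt (hC : IsTotallyDisconnected C) {u v : ℝ} (h : u < v) :
    ∃ x ∈ Ioo u v, x ∉ C := by
  by_contra! hsub
  obtain ⟨p, hp⟩ := exists_between h
  obtain ⟨q, hq⟩ := exists_between hp.2
  exact hq.1.ne (hC (Ioo u v) hsub isPreconnected_Ioo hp ⟨hp.1.trans hq.1, hq.2⟩)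

lemma exists_mem_ne_of_preperfect (hC : Preperfect C) {u b v : ℝ} (hb : b ∈ C) (hub : u < b)
    (hbv : b < v) : ∃ x ∈ C, x ≠ b ∧ u < x ∧ x < v := by
  obtain ⟨y, hy, hne⟩ := preperfect_iff_nhds.1 hC b hb _ (Ioo_mem_nhds hub hbv)
  exact ⟨y, hy.2, hne, hy.1.1, hy.1.2⟩

lemma exists_isGap (hC : IsClosed C) {u x v : ℝ} (hu : u ∈ C) (hv : v ∈ C) (hux : u ≤ x)
    (hxv : x ≤ v) (hx : x ∉ C) : ∃ a b, IsGap C a b ∧ a < x ∧ x < b ∧ u ≤ a ∧ b ≤ v := by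
  have hbA : BddAbove (C ∩ Iic x) := ⟨x, fun y hy => hy.2⟩
  have hbB : BddBelow (C ∩ Ici x) := ⟨x, fun y hy => hy.2⟩
  have hA := (hC.inter isClosed_Iic).csSup_mem ⟨u, hu, hux⟩ hbA
  have hB := (hC.inter isClosed_Ici).csInf_mem ⟨v, hv, hxv⟩ hbB
  have hlt : sSup (C ∩ Iic x) < x := lt_of_le_of_ne hA.2 fun h => hx (h ▸ hA.1)
  have hgt : x < sInf (C ∩ Ici x) := lt_of_le_of_ne hB.2 fun h => hx (h ▸ hB.1)
  refine ⟨_, _, ⟨hA.1, hB.1, hlt.trans hgt, fun y hy hyC => ?_⟩, hlt, hgt,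
    le_csSup hbA ⟨hu, hux⟩, csInf_le hbB ⟨hv, hxv⟩⟩
  rcases le_total y x with h | h
  · exact hy.1.not_ge (le_csSup hbA ⟨hyC, h⟩)
  · exact hy.2.not_ge (csInf_le hbB ⟨hyC, h⟩)

lemma IsCantorSet.exists_isGap_between (hC : IsCantorSet C) {u v : ℝ} (hu : u ∈ C) (hv : v ∈ C)
    (huv : u < v) : ∃ a b, IsGap C a b ∧ u ≤ a ∧ b ≤ v := by
  obtain ⟨x, hx, hxC⟩ := exists_notMem_of_lt hC.2.2.1 huv
  obtain ⟨a, b, h, -, -, ha, hb⟩ := exists_isGap hC.2.1.isClosed hu hv hx.1.le hx.2.le hxC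
  exact ⟨a, b, h, ha, hb⟩

lemma countable_gapLeft (C : Set ℝ) : (gapLeft C).Countable := by
  choose! r hr using fun (a : ℝ) (ha : a ∈ gapLeft C) => ha
  refine Set.PairwiseDisjoint.countable_of_Ioo (y := r) ?_ fun a ha => (hr a ha).2.2.1
  intro a ha b hb hab
  refine Set.disjoint_left.2 fun x hxa hxb => ?_
  rcases lt_or_gt_of_ne hab with h | h
  · exact absurd ((hr a ha).le_of_mem_of_lt (hr b hb).1 h) (not_le.2 (hxb.1.trans hxa.2))
  · exact absurd ((hr b hb).le_of_mem_of_lt (hr a ha).1 h) (not_le.2 (hxa.1.trans hxb.2))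

lemma IsCantorSet.denselyOrdered_gapLeft (hC : IsCantorSet C) : DenselyOrdered (gapLeft C) := by
  refine ⟨?_⟩
  rintro ⟨a, b, hab⟩ ⟨c, d, hcd⟩ (hac : a < c)
  have hbc : b < c := by
    refine lt_of_le_of_ne (hab.le_of_mem_of_lt hcd.1 hac) ?_
    rintro rfl
    obtain ⟨x, hx, hne, h1, h2⟩ := exists_mem_ne_of_preperfect hC.2.2.2 hcd.1 hac hcd.2.2.1
    rcases lt_or_gt_of_ne hne with h | h
    · exact hab.2.2.2 x ⟨h1, h⟩ hx
    · exact hcd.2.2.2 x ⟨h, h2⟩ hx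
  obtain ⟨p, q, hpq, hp, hq⟩ := hC.exists_isGap_between hab.2.1 hcd.1 hbc
  exact ⟨⟨p, q, hpq⟩, Subtype.mk_lt_mk.2 (hab.2.2.1.trans_le hp),
    Subtype.mk_lt_mk.2 (hpq.2.2.1.trans_le hq)⟩

lemma IsCantorSet.noMinOrder_gapLeft (hC : IsCantorSet C) : NoMinOrder (gapLeft C) := by
  refine ⟨?_⟩
  rintro ⟨a, b, hab⟩
  obtain ⟨u, hu, hua⟩ : ∃ u ∈ C, u < a := by
    obtain ⟨x, hx, hne, -, h2⟩ :=
      exists_mem_ne_of_preperfect hC.2.2.2 hab.1 (sub_one_lt a) hab.2.2.1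
    refine ⟨x, hx, lt_of_le_of_ne ?_ hne⟩
    exact hab.le_of_mem_of_gt hx h2
  obtain ⟨p, q, hpq, -, hq⟩ := hC.exists_isGap_between hu hab.1 hua
  exact ⟨⟨p, q, hpq⟩, Subtype.mk_lt_mk.2 (hpq.2.2.1.trans_le hq)⟩

lemma IsCantorSet.noMaxOrder_gapLeft (hC : IsCantorSet C) : NoMaxOrder (gapLeft C) := by
  refine ⟨?_⟩
  rintro ⟨a, b, hab⟩
  obtain ⟨u, hu, hbu⟩ : ∃ u ∈ C, b < u := by
    obtain ⟨x, hx, hne, h1, -⟩ :=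
      exists_mem_ne_of_preperfect hC.2.2.2 hab.2.1 hab.2.2.1 (lt_add_one b)
    refine ⟨x, hx, lt_of_le_of_ne ?_ hne.symm⟩
    exact hab.le_of_mem_of_lt hx h1
  obtain ⟨p, q, hpq, hp, -⟩ := hC.exists_isGap_between hab.2.1 hu hbu
  exact ⟨⟨p, q, hpq⟩, Subtype.mk_lt_mk.2 (hab.2.2.1.trans_le hp)⟩

lemma IsCantorSet.nonempty_gapLeft (hC : IsCantorSet C) : Nonempty (gapLeft C) := by
  obtain ⟨x, hx⟩ := hC.1
  obtain ⟨y, hy, hne, -⟩ := exists_mem_ne_of_preperfect hC.2.2.2 hx (sub_one_lt x) (lt_add_one x)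
  rcases lt_or_gt_of_ne hne with h | h
  · obtain ⟨p, q, hpq, -⟩ := hC.exists_isGap_between hy hx h
    exact ⟨⟨p, q, hpq⟩⟩
  · obtain ⟨p, q, hpq, -⟩ := hC.exists_isGap_between hx hy h
    exact ⟨⟨p, q, hpq⟩⟩

lemma IsCantorSet.nonempty_gapLeft_orderIso (hC : IsCantorSet C) (hD : IsCantorSet D) :
    Nonempty (gapLeft C ≃o gapLeft D) := by
  have := hC.denselyOrdered_gapLeft
  have := hD.denselyOrdered_gapLeft
  have := hC.noMinOrder_gapLeft
  have := hD.noMinOrder_gapLeft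
  have := hC.noMaxOrder_gapLeft
  have := hD.noMaxOrder_gapLeft
  have := hC.nonempty_gapLeft
  have := hD.nonempty_gapLeft
  have := (countable_gapLeft C).to_subtype
  have := (countable_gapLeft D).to_subtype
  exact Order.iso_of_countable_dense _ _

/-- The correspondence between the complements of `C` and `D` induced by an order isomorphism of
their gaps: affine on each gap, and a translation on either unbounded component. -/
def gapRel (φ : gapLeft C ≃o gapLeft D) (x y : ℝ) : Prop :=
  (∃ m m', IsLeast C m ∧ IsLeast D m' ∧ x < m ∧ y - m' = x - m) ∨
  (∃ M M', IsGreatest C M ∧ IsGreatest D M' ∧ M < x ∧ y - M' = x - M) ∨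
  ∃ (a : gapLeft C) (b b' t : ℝ), IsGap C a b ∧ IsGap D (φ a) b' ∧ 0 < t ∧ t < 1 ∧
    x = a + t * (b - a) ∧ y = φ a + t * (b' - φ a)

lemma gapRel.symm {φ : gapLeft C ≃o gapLeft D} {x y : ℝ} (h : gapRel φ x y) :
    gapRel φ.symm y x := by
  rcases h with ⟨m, m', hm, hm', h1, h2⟩ | ⟨M, M', hM, hM', h1, h2⟩ |
    ⟨a, b, b', t, hab, hab', h0, h1, hx, hy⟩
  · exact Or.inl ⟨m', m, hm', hm, by linarith, h2.symm⟩
  · exact Or.inr (Or.inl ⟨M', M, hM', hM, by linarith, h2.symm⟩)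
  · exact Or.inr (Or.inr ⟨φ a, b', b, t, hab', by simpa using hab, h0, h1, hy, by simpa using hx⟩)

lemma IsGap.lt_affine {a b t : ℝ} (h : IsGap C a b) (h0 : 0 < t) : a < a + t * (b - a) := by
  have := mul_pos h0 (sub_pos.2 h.2.2.1)
  linarith

lemma IsGap.affine_lt {a b t : ℝ} (h : IsGap C a b) (h1 : t < 1) : a + t * (b - a) < b := by
  have := mul_pos (sub_pos.2 h1) (sub_pos.2 h.2.2.1)
  linarith

lemma IsGap.eq_right {a b c : ℝ} (h : IsGap C a b) (h' : IsGap C a c) : b = c :=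
  le_antisymm (h.le_of_mem_of_lt h'.2.1 h'.2.2.1) (h'.le_of_mem_of_lt h.2.1 h.2.2.1)

lemma gapRel.notMem {φ : gapLeft C ≃o gapLeft D} {x y : ℝ} (h : gapRel φ x y) : x ∉ C := by
  rcases h with ⟨m, m', hm, hm', h1, h2⟩ | ⟨M, M', hM, hM', h1, h2⟩ |
    ⟨a, b, b', t, hab, hab', h0, h1, rfl, rfl⟩
  · exact fun hx => h1.not_ge (hm.2 hx)
  · exact fun hx => h1.not_ge (hM.2 hx)
  · exact hab.2.2.2 _ ⟨hab.lt_affine h0, hab.affine_lt h1⟩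

lemma gapRel.lt {φ : gapLeft C ≃o gapLeft D} {x y x' y' : ℝ} (h : gapRel φ x y)
    (h' : gapRel φ x' y') (hlt : x < x') : y < y' := by
  rcases h with ⟨m, m', hm, hm', h1, h2⟩ | ⟨M, M', hM, hM', h1, h2⟩ |
    ⟨a, b, b', t, hab, hab', h0, h1, rfl, rfl⟩ <;>
  rcases h' with ⟨n, n', hn, hn', k1, k2⟩ | ⟨N, N', hN, hN', k1, k2⟩ |
    ⟨c, d, d', s, hcd, hcd', k0, k1, rfl, rfl⟩
  · have := hm.unique hn
    have := hm'.unique hn'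
    linarith
  · have := hm'.2 hN'.1
    linarith
  · have := hm'.2 hcd'.1
    have := hcd'.lt_affine k0
    linarith
  · have := hM.2 hn.1
    linarith
  · have := hM.unique hN
    have := hM'.unique hN'
    linarith
  · have := hM.2 hcd.2.1
    have := hcd.affine_lt k1
    linarith
  · have := hn.2 hab.1
    have := hab.lt_affine h0
    linarith
  · have := hN'.2 hab'.2.1
    have := hab'.affine_lt h1
    linarith
  · rcases lt_trichotomy a c with hac | rfl | hac
    · have := hab'.le_of_mem_of_lt hcd'.1 (φ.strictMono hac)
      have := hab'.affine_lt h1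
      have := hcd'.lt_affine k0
      linarith
    · obtain rfl := hab.eq_right hcd
      obtain rfl := hab'.eq_right hcd'
      have hts := lt_of_mul_lt_mul_right (lt_of_add_lt_add_left hlt) (sub_pos.2 hab.2.2.1).le
      have := mul_lt_mul_of_pos_right hts (sub_pos.2 hab'.2.2.1)
      linarith
    · have := hcd.le_of_mem_of_lt hab.1 hac
      have := hcd.affine_lt k1
      have := hab.lt_affine h0
      linarith

lemma IsCantorSet.exists_gapRel (hC : IsCantorSet C) (hD : IsCantorSet D)
    (φ : gapLeft C ≃o gapLeft D) {x : ℝ} (hx : x ∉ C) : ∃ y, gapRel φ x y := by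
  obtain ⟨m, hm⟩ := hC.2.1.exists_isLeast hC.1
  obtain ⟨m', hm'⟩ := hD.2.1.exists_isLeast hD.1
  obtain ⟨M, hM⟩ := hC.2.1.exists_isGreatest hC.1
  obtain ⟨M', hM'⟩ := hD.2.1.exists_isGreatest hD.1
  rcases lt_or_ge x m with h | hmx
  · exact ⟨x - m + m', Or.inl ⟨m, m', hm, hm', h, by ring⟩⟩
  rcases lt_or_ge M x with h | hxM
  · exact ⟨x - M + M', Or.inr (Or.inl ⟨M, M', hM, hM', h, by ring⟩)⟩
  obtain ⟨a, b, hab, hax, hxb, -⟩ := exists_isGap hC.2.1.isClosed hm.1 hM.1 hmx hxM hx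
  obtain ⟨b', hb'⟩ := (φ ⟨a, b, hab⟩).2
  have hpos : 0 < b - a := sub_pos.2 hab.2.2.1
  refine ⟨_, Or.inr (Or.inr ⟨⟨a, b, hab⟩, b, b', (x - a) / (b - a), hab, hb',
    div_pos (sub_pos.2 hax) hpos, (div_lt_one hpos).2 (by linarith), ?_, rfl⟩)⟩
  simp [div_mul_cancel₀ _ hpos.ne']

/-- An order-preserving correspondence between dense sets of reals extends to an order isomorphism
of `ℝ`. -/
theorem exists_orderIso_of_dense_rel {R : ℝ → ℝ → Prop}
    (hR : ∀ {x y x' y'}, R x y → R x' y' → (x < x' ↔ y < y'))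
    (hX : Dense {x | ∃ y, R x y}) (hY : Dense {y | ∃ x, R x y}) :
    ∃ e : ℝ ≃o ℝ, ∀ x y, R x y → e x = y := by
  let S (x : ℝ) : Set ℝ := {y | ∃ x' < x, R x' y}
  have hbdd (x : ℝ) : BddAbove (S x) := by
    obtain ⟨p, ⟨q, hpq⟩, hp⟩ := hX.exists_gt x
    exact ⟨q, fun y ⟨x', hx', h⟩ => ((hR h hpq).1 (hx'.trans hp)).le⟩
  have hne (x : ℝ) : (S x).Nonempty := by
    obtain ⟨p, ⟨q, hpq⟩, hp⟩ := hX.exists_lt x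
    exact ⟨q, p, hp, hpq⟩
  have hmono : StrictMono fun x => sSup (S x) := by
    intro x₁ x₂ h
    obtain ⟨p, ⟨p', hp'⟩, hp⟩ := hX.exists_between h
    obtain ⟨q, ⟨q', hq'⟩, hq⟩ := hX.exists_between hp.2
    calc sSup (S x₁) ≤ p' :=
          csSup_le (hne x₁) fun y ⟨x', hx', h⟩ => ((hR h hp').1 (hx'.trans hp.1)).le
      _ < q' := (hR hp' hq').1 hq.1
      _ ≤ sSup (S x₂) := le_csSup (hbdd x₂) ⟨q, hq.2, hq'⟩
  have hsurj : Function.Surjective fun x => sSup (S x) := by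
    intro y
    let T : Set ℝ := {x | ∃ y' < y, R x y'}
    have hTb : BddAbove T := by
      obtain ⟨q, ⟨p, hpq⟩, hq⟩ := hY.exists_gt y
      exact ⟨p, fun x ⟨y', hy', h⟩ => ((hR h hpq).2 (hy'.trans hq)).le⟩
    have hTn : T.Nonempty := by
      obtain ⟨q, ⟨p, hpq⟩, hq⟩ := hY.exists_lt y
      exact ⟨p, q, hq, hpq⟩
    refine ⟨sSup T, le_antisymm (csSup_le (hne _) ?_) (le_of_forall_lt fun c hc => ?_)⟩
    · rintro y' ⟨x', hx', h⟩
      obtain ⟨x'', ⟨y'', hy'', h''⟩, hlt⟩ := exists_lt_of_lt_csSup hTn hx'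
      exact (((hR h h'').1 hlt).trans hy'').le
    · obtain ⟨q, ⟨p, hpq⟩, hq⟩ := hY.exists_between hc
      obtain ⟨s, ⟨r, hrs⟩, hs⟩ := hY.exists_between hq.2
      exact hq.1.trans_le (le_csSup (hbdd _)
        ⟨p, ((hR hpq hrs).2 hs.1).trans_le (le_csSup hTb ⟨s, hs.2, hrs⟩), hpq⟩)
  refine ⟨hmono.orderIsoOfSurjective _ hsurj, fun x y hxy => ?_⟩
  change sSup (S x) = y
  refine le_antisymm (csSup_le (hne _) fun y' ⟨x', hx', h⟩ => ((hR h hxy).1 hx').le)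
    (le_of_forall_lt fun c hc => ?_)
  obtain ⟨q, ⟨p, hpq⟩, hq⟩ := hY.exists_between hc
  exact hq.1.trans_le (le_csSup (hbdd _) ⟨p, (hR hpq hxy).2 hq.2, hpq⟩)

lemma dense_compl_of_isTotallyDisconnected (hC : IsTotallyDisconnected C) : Dense Cᶜ :=
  dense_of_exists_between fun _ _ h => let ⟨x, hx, hxC⟩ := exists_notMem_of_lt hC h
    ⟨x, hxC, hx.1, hx.2⟩

/-- Any two Cantor sets correspond under an order isomorphism of `ℝ`. -/
theorem IsCantorSet.exists_orderIso_image_eq (hC : IsCantorSet C) (hD : IsCantorSet D) :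
    ∃ e : ℝ ≃o ℝ, e '' C = D := by
  obtain ⟨φ⟩ := hC.nonempty_gapLeft_orderIso hD
  have hdom {x : ℝ} (hx : x ∉ C) : ∃ y, gapRel φ x y := hC.exists_gapRel hD φ hx
  have hcod {y : ℝ} (hy : y ∉ D) : ∃ x, gapRel φ x y := by
    obtain ⟨x, hx⟩ := hD.exists_gapRel hC φ.symm hy
    exact ⟨x, hx.symm⟩
  obtain ⟨e, he⟩ := exists_orderIso_of_dense_rel (R := gapRel φ)
    (fun h h' => ⟨h.lt h', h.symm.lt h'.symm⟩)
    ((dense_compl_of_isTotallyDisconnected hC.2.2.1).mono fun x hx => hdom hx)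
    ((dense_compl_of_isTotallyDisconnected hD.2.2.1).mono fun y hy => hcod hy)
  refine ⟨e, Subset.antisymm ?_ fun y hy => ?_⟩
  · rintro _ ⟨x, hx, rfl⟩
    by_contra hy
    obtain ⟨x', h⟩ := hcod hy
    obtain rfl := e.injective (he _ _ h)
    exact h.notMem hx
  · refine ⟨e.symm y, ?_, e.apply_symm_apply y⟩
    by_contra hx
    obtain ⟨y', h⟩ := hdom hx
    have := he _ _ h
    rw [e.apply_symm_apply] at this
    exact h.symm.notMem (this ▸ hy)

lemma IsCantorSet.image_homeomorph (hC : IsCantorSet C) (e : ℝ ≃ₜ ℝ) : IsCantorSet (e '' C) := by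
  refine ⟨hC.1.image e, hC.2.1.image e.continuous,
    e.isEmbedding.isTotallyDisconnected_image.2 hC.2.2.1, ?_⟩
  rw [preperfect_iff_nhds]
  rintro _ ⟨x, hx, rfl⟩ U hU
  obtain ⟨y, hy, hne⟩ := preperfect_iff_nhds.1 hC.2.2.2 x hx _ (e.continuous.continuousAt hU)
  exact ⟨e y, ⟨hy.1, mem_image_of_mem e hy.2⟩, e.injective.ne hne⟩

theorem cantorTernarySet_eq_cantorSet : cantorTernarySet = cantorSet := by
  rw [cantorSet_eq_zero_two_ofDigits]
  ext x
  constructor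
  · rintro ⟨a, ha, rfl⟩
    refine ⟨fun n => if a n = 0 then 0 else 2, fun n => by dsimp only; split_ifs <;> decide, ?_⟩
    refine tsum_congr fun n => ?_
    rcases ha n with h | h <;> simp [Real.ofDigitsTerm, h, div_eq_mul_inv]
  · rintro ⟨a, ha, rfl⟩
    refine ⟨fun n => ((a n : ℕ) : ℝ), fun n => ?_, ?_⟩
    · have := ha n
      dsimp only
      generalize a n = d at this ⊢
      fin_cases d <;> simp at this ⊢
    · exact tsum_congr fun n => by simp [Real.ofDigitsTerm, div_eq_mul_inv]

lemma exists_mem_cantorSet_ne_abs_sub_le (n : ℕ) {x : ℝ} (hx : x ∈ cantorSet) :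
    ∃ y ∈ cantorSet, y ≠ x ∧ |y - x| ≤ (1 / 3) ^ n := by
  induction n generalizing x with
  | zero =>
    have hx' := cantorSet_subset_unitInterval hx
    rcases eq_or_ne x 0 with rfl | h
    · exact ⟨1 / 4, quarter_mem_cantorSet, by norm_num, by norm_num [abs_le]⟩
    · exact ⟨0, zero_mem_cantorSet, h.symm, by simpa [abs_of_nonneg hx'.1] using hx'.2⟩
  | succ n ih =>
    rw [cantorSet_eq_union_halves] at hx
    rcases hx with ⟨z, hz, rfl⟩ | ⟨z, hz, rfl⟩ <;> obtain ⟨y, hy, hne, hle⟩ := ih hz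
    · refine ⟨y / 3, ?_, by grind, ?_⟩
      · rw [cantorSet_eq_union_halves]
        exact Or.inl ⟨y, hy, rfl⟩
      · rw [pow_succ, ← sub_div, abs_div, abs_of_pos (three_pos : (0 : ℝ) < 3)]
        linarith
    · refine ⟨(2 + y) / 3, ?_, by grind, ?_⟩
      · rw [cantorSet_eq_union_halves]
        exact Or.inr ⟨y, hy, rfl⟩
      · rw [pow_succ, ← sub_div, add_sub_add_left_eq_sub, abs_div,
          abs_of_pos (three_pos : (0 : ℝ) < 3)]
        linarith

theorem isCantorSet_cantorTernarySet : IsCantorSet cantorTernarySet := by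
  rw [cantorTernarySet_eq_cantorSet]
  refine ⟨⟨0, zero_mem_cantorSet⟩, isCompact_cantorSet, ?_, ?_⟩
  · rw [← totallyDisconnectedSpace_subtype_iff]
    exact cantorSetHomeomorphNatToBool.symm.totallyDisconnectedSpace
  · rw [preperfect_iff_nhds]
    intro x hx U hU
    obtain ⟨ε, hε, hball⟩ := Metric.mem_nhds_iff.1 hU
    obtain ⟨n, hn⟩ := exists_pow_lt_of_lt_one hε (by norm_num : (1 / 3 : ℝ) < 1)
    obtain ⟨y, hy, hne, hle⟩ := exists_mem_cantorSet_ne_abs_sub_le n hx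
    exact ⟨y, ⟨hball (hle.trans_lt hn), hy⟩, hne⟩

end

/-- A nonempty set C ⊆ ℝ is compact, totally disconnected and dense in itself
iff C = f(𝔻) for some increasing bijection f : ℝ → ℝ. -/
theorem cantorSet_iff_image_of_increasing_bijection (C : Set ℝ) (hC : C.Nonempty) :
    (IsCompact C ∧ IsTotallyDisconnected C ∧ Preperfect C) ↔
      ∃ f : ℝ → ℝ, StrictMono f ∧ Function.Bijective f ∧ C = f '' cantorTernarySet := by
  constructor
  · intro h
    obtain ⟨e, he⟩ := isCantorSet_cantorTernarySet.exists_orderIso_image_eq ⟨hC, h⟩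
    exact ⟨e, e.strictMono, e.bijective, he.symm⟩
  · rintro ⟨f, hf, hbij, rfl⟩
    exact (isCantorSet_cantorTernarySet.image_homeomorph
      (hf.orderIsoOfSurjective f hbij.surjective).toHomeomorph).2
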